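/- arXiv:1603.07033 — 2 statements merged into one kernel-verified Lean document; each statement's English description precedes it below -/
import Mathlib

section
/- If f : ℝ → ℝ is continuously differentiable, periodic with period T > 0, and has zero average over (0,T), then ∫₀ᵀ f'(t)² dt ≥ ω² ∫₀ᵀ f(t)² dt, where ω = 2π/T. -/
open MeasureTheory intervalIntegral Real

lemma memLp_aux (T : ℝ) (g : ℝ → ℝ) (hg : Continuous g) :
    MemLp (fun x => (g x : ℂ)) 2 (volume.restrict (Set.Ioc 0 T)) := by
  have hc : Continuous (fun x => (g x : ℂ)) := Complex.continuous_ofReal.comp hg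
  obtain ⟨C, hC⟩ := (isCompact_Icc (a := (0:ℝ)) (b := T)).exists_bound_of_continuousOn
    hc.continuousOn
  refine MemLp.of_bound hc.aestronglyMeasurable C ?_
  filter_upwards [ae_restrict_mem measurableSet_Ioc] with x hx
  exact hC x (Set.Ioc_subset_Icc_self hx)

/-- Wirtinger's inequality for zero-average `T`-periodic `C¹` functions. -/
theorem wirtinger_inequality (T : ℝ) (hT : 0 < T) (f : ℝ → ℝ)
    (hf : ContDiff ℝ 1 f) (hper : Function.Periodic f T)
    (havg : ∫ t in (0:ℝ)..T, f t = 0) :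
    ∫ t in (0:ℝ)..T, (deriv f t) ^ 2 ≥ (2 * π / T) ^ 2 * ∫ t in (0:ℝ)..T, (f t) ^ 2 := by
  have hd : Continuous (deriv f) := hf.continuous_deriv le_rfl
  have h1 := hasSum_sq_fourierCoeffOn hT (memLp_aux T f hf.continuous)
  have h2 := hasSum_sq_fourierCoeffOn hT (memLp_aux T _ hd)
  have key : ∀ n : ℤ, (2 * π / T) ^ 2 * ‖fourierCoeffOn hT (fun x => (f x : ℂ)) n‖ ^ 2 ≤
      ‖fourierCoeffOn hT (fun x => ((deriv f x : ℝ) : ℂ)) n‖ ^ 2 := by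
    intro n
    by_cases hn : n = 0
    · subst hn
      have : fourierCoeffOn hT (fun x => (f x : ℂ)) 0 = 0 := by
        rw [fourierCoeffOn_eq_integral]
        simp [intervalIntegral.integral_ofReal, havg]
      rw [this]
      simp
    · have h := fourierCoeffOn_of_hasDerivAt hT (f := fun x => (f x : ℂ))
        (f' := fun x => ((deriv f x : ℝ) : ℂ)) hn
        (fun x _ => ((hf.differentiable one_ne_zero x).hasDerivAt).ofReal_comp)
        ((Complex.continuous_ofReal.comp hd).intervalIntegrable _ _)
      have hT0 : f T = f 0 := by simpa using hper 0
      have hn1 : (1:ℝ) ≤ |(n:ℝ)| := by exact_mod_cast Int.one_le_abs hn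
      have h' : ‖fourierCoeffOn hT (fun x => (f x : ℂ)) n‖ =
          1 / (2 * π * |(n:ℝ)|) * (T * ‖fourierCoeffOn hT (fun x => ((deriv f x : ℝ) : ℂ)) n‖) := by
        rw [h, hT0]
        simp [abs_of_pos hT, abs_of_pos pi_pos]
      rw [← mul_pow]
      refine pow_le_pow_left₀ (by positivity) ?_ 2
      rw [h']
      have : 2 * π / T * (1 / (2 * π * |(n:ℝ)|) *
          (T * ‖fourierCoeffOn hT (fun x => ((deriv f x : ℝ) : ℂ)) n‖)) =
          ‖fourierCoeffOn hT (fun x => ((deriv f x : ℝ) : ℂ)) n‖ / |(n:ℝ)| := by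
        have := pi_pos
        field_simp
      rw [this]
      exact div_le_self (norm_nonneg _) hn1
  have h3 := hasSum_le key (h1.mul_left _) h2
  simp only [Complex.norm_real, Real.norm_eq_abs, sq_abs, sub_zero, smul_eq_mul] at h3
  rw [mul_left_comm] at h3
  exact le_of_mul_le_mul_left h3 (inv_pos.mpr hT)
end

section
/- Let h : ℝ → ℝ be continuous and T-periodic with h(t) < c²/4 + ω² for all t (ω = 2π/T), and suppose the T-periodic problem w'' + c·w' + h(t)·w = 0 has a nontrivial solution w. Then the adjoint problem v'' − c·v' + h(t)·v = 0 also has a nontrivial T-periodic solution v, and v can be chosen with v(t) > 0 for all t. -/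
open MeasureTheory intervalIntegral Real

lemma sturm_half_pos (om c : ℝ) (hom : 0 < om) (h w w1 : ℝ → ℝ)
    (hb : ∀ t, h t < c ^ 2 / 4 + om ^ 2)
    (hw : ∀ t, HasDerivAt w (w1 t) t)
    (hw1 : ∀ t, HasDerivAt w1 (-c * w1 t - h t * w t) t)
    (h0 : w 0 = 0) (h1 : 0 < w1 0) : 0 < w (π / om) := by
  by_contra hneg
  push Not at hneg
  have hm : 0 < π / om := div_pos pi_pos hom
  have hwc : Continuous w := continuous_iff_continuousAt.2 fun t => (hw t).continuousAt
  -- positivity near zero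
  have hnear : ∃ δ, 0 < δ ∧ ∀ t, 0 < t → t < δ → 0 < w t := by
    have hs := (hasDerivAt_iff_tendsto_slope.1 (hw 0)).eventually (lt_mem_nhds h1)
    rw [eventually_nhdsWithin_iff, Metric.eventually_nhds_iff] at hs
    obtain ⟨δ, hδ, H⟩ := hs
    refine ⟨δ, hδ, fun t ht htd => ?_⟩
    have := H (y := t) (by simpa [abs_of_pos ht] using htd) (by simpa using ht.ne')
    rw [slope_def_field, h0, sub_zero, sub_zero] at this
    exact (div_pos_iff_of_pos_right ht).1 this
  obtain ⟨δ, hδ, hδw⟩ := hnear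
  have hδm : δ ≤ π / om := by
    by_contra hlt
    push Not at hlt
    exact absurd (hδw _ hm hlt) (not_lt.2 hneg)
  have hZ : IsCompact (Set.Icc δ (π / om) ∩ {t | w t ≤ 0}) :=
    isCompact_Icc.inter_right (isClosed_le hwc continuous_const)
  obtain ⟨b, ⟨⟨hb1, hb2⟩, hb3⟩, hbl⟩ := hZ.exists_isLeast ⟨π / om, ⟨hδm, le_rfl⟩, hneg⟩
  have hbpos : 0 < b := hδ.trans_le hb1
  have hpos : ∀ t, 0 < t → t < b → 0 < w t := by
    intro t ht htb
    by_cases htd : t < δ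
    · exact hδw t ht htd
    · by_contra hc
      push Not at hc htd
      exact absurd (hbl ⟨⟨htd, htb.le.trans hb2⟩, hc⟩) (not_le.2 htb)
  have hev : ∀ᶠ t in nhdsWithin b (Set.Iio b), 0 < t ∧ t < b := by
    filter_upwards [Ioo_mem_nhdsLT hbpos] with t ht using ht
  have hwb : w b = 0 := by
    refine le_antisymm hb3 ?_
    refine ge_of_tendsto (hwc.continuousAt.tendsto.mono_left (nhdsWithin_le_nhds (s := Set.Iio b))) ?_
    filter_upwards [hev] with t ht using (hpos t ht.1 ht.2).le
  have hw1b : w1 b ≤ 0 := by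
    have hs := (hasDerivAt_iff_tendsto_slope.1 (hw b)).mono_left
      (nhdsWithin_mono b (s := Set.Iio b) (fun x hx => ne_of_lt hx))
    refine le_of_tendsto hs ?_
    filter_upwards [hev] with t ht
    rw [slope_def_field, hwb, sub_zero]
    exact (div_neg_of_pos_of_neg (hpos t ht.1 ht.2) (by linarith [ht.2])).le
  let W : ℝ → ℝ := fun t => exp (c / 2 * t) *
    ((w1 t + c / 2 * w t) * sin (om * t) - om * w t * cos (om * t))
  have hW : ∀ t, HasDerivAt W (exp (c / 2 * t) * (sin (om * t) * w t *
      (c ^ 2 / 4 + om ^ 2 - h t))) t := by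
    intro t
    have e1 : HasDerivAt (fun t => exp (c / 2 * t)) (exp (c / 2 * t) * (c / 2)) t := by
      simpa using ((hasDerivAt_id t).const_mul (c / 2)).exp
    have e2 : HasDerivAt (fun t => sin (om * t)) (cos (om * t) * om) t := by
      simpa using ((hasDerivAt_id t).const_mul om).sin
    have e3 : HasDerivAt (fun t => cos (om * t)) (-sin (om * t) * om) t := by
      simpa using ((hasDerivAt_id t).const_mul om).cos
    have := e1.fun_mul ((((hw1 t).fun_add ((hw t).const_mul (c / 2))).fun_mul e2).fun_sub
      (((hw t).const_mul om).fun_mul e3))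
    refine HasDerivAt.congr_deriv (this) ?_
    ring
  have hmono : StrictMonoOn W (Set.Icc 0 b) := by
    refine strictMonoOn_of_deriv_pos (convex_Icc 0 b)
      (fun t _ => (hW t).continuousAt.continuousWithinAt) ?_
    intro t ht
    rw [interior_Icc] at ht
    rw [(hW t).deriv]
    have hsin : 0 < sin (om * t) := by
      refine sin_pos_of_pos_of_lt_pi (mul_pos hom ht.1) ?_
      have := (lt_div_iff₀ hom).1 (ht.2.trans_le hb2)
      linarith
    exact mul_pos (exp_pos _) (mul_pos (mul_pos hsin (hpos t ht.1 ht.2)) (by linarith [hb t]))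
  have hlt := hmono (Set.left_mem_Icc.2 hbpos.le) (Set.right_mem_Icc.2 hbpos.le) hbpos
  have hW0 : W 0 = 0 := by simp [W, h0]
  have hWb : W b ≤ 0 := by
    have hsin : 0 ≤ sin (om * b) := by
      refine sin_nonneg_of_nonneg_of_le_pi (mul_pos hom hbpos).le ?_
      have := (le_div_iff₀ hom).1 hb2
      linarith
    simp only [W, hwb, mul_zero, add_zero, zero_mul, sub_zero]
    exact mul_nonpos_of_nonneg_of_nonpos (exp_pos _).le
      (mul_nonpos_of_nonpos_of_nonneg hw1b hsin)
  linarith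

lemma zero_of_cauchy (c M : ℝ) (h w w1 : ℝ → ℝ) (hM : ∀ t, |h t| ≤ M)
    (hw : ∀ t, HasDerivAt w (w1 t) t)
    (hw1 : ∀ t, HasDerivAt w1 (-c * w1 t - h t * w t) t) (t0 : ℝ)
    (h0 : w t0 = 0) (h1 : w1 t0 = 0) (t : ℝ) (ht : t0 ≤ t) : w t = 0 := by
  let K := 1 + M + 2 * |c|
  let E : ℝ → ℝ := fun t => exp (-K * t) * (w t ^ 2 + w1 t ^ 2)
  have hE : ∀ t, HasDerivAt E (exp (-K * t) * (2 * w t * w1 t * (1 - h t) - 2 * c * w1 t ^ 2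
      - K * (w t ^ 2 + w1 t ^ 2))) t := by
    intro t
    have e1 : HasDerivAt (fun t => exp (-K * t)) (exp (-K * t) * (-K)) t := by
      simpa using ((hasDerivAt_id t).const_mul (-K)).exp
    have := e1.fun_mul (((hw t).fun_pow 2).fun_add ((hw1 t).fun_pow 2))
    refine HasDerivAt.congr_deriv (this) ?_
    push_cast
    ring
  have hanti : Antitone E := by
    refine antitone_of_deriv_nonpos (fun t => (hE t).differentiableAt) fun t => ?_
    rw [(hE t).deriv]
    refine mul_nonpos_of_nonneg_of_nonpos (exp_pos _).le ?_
    have a1 := abs_le.1 (hM t)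
    have a2 : -c ≤ |c| := neg_le_abs c
    have a3 : 0 ≤ |c| := abs_nonneg c
    have b1 : 0 ≤ (|c| + c) * w1 t ^ 2 := mul_nonneg (by linarith) (sq_nonneg _)
    have b2 : 0 ≤ |c| * w t ^ 2 := mul_nonneg a3 (sq_nonneg _)
    have b3 : 0 ≤ (M - h t) * (w t + w1 t) ^ 2 := mul_nonneg (by linarith) (sq_nonneg _)
    have b4 : 0 ≤ (M + h t) * (w t + w1 t) ^ 2 := mul_nonneg (by linarith) (sq_nonneg _)
    have b5 : 0 ≤ (M + h t) * (w t - w1 t) ^ 2 := mul_nonneg (by linarith) (sq_nonneg _)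
    have b6 : 0 ≤ (M - h t) * (w t - w1 t) ^ 2 := mul_nonneg (by linarith) (sq_nonneg _)
    have b7 := sq_nonneg (w t - w1 t)
    simp only [K]
    nlinarith
  have h2 := hanti ht
  have h3 : E t0 = 0 := by simp [E, h0, h1]
  rw [h3] at h2
  have h4 : w t ^ 2 + w1 t ^ 2 ≤ 0 := by
    by_contra hc
    push Not at hc
    exact absurd h2 (not_le.2 (mul_pos (exp_pos _) hc))
  nlinarith [sq_nonneg (w t), sq_nonneg (w1 t)]

lemma no_zero (T c : ℝ) (hT : 0 < T) (h w w1 : ℝ → ℝ)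
    (hhbd : ∀ t, h t < c ^ 2 / 4 + (2 * π / T) ^ 2)
    (hw : ∀ t, HasDerivAt w (w1 t) t)
    (hw1 : ∀ t, HasDerivAt w1 (-c * w1 t - h t * w t) t)
    (hper : Function.Periodic w T) (hper1 : Function.Periodic w1 T)
    (t0 : ℝ) (h0 : w t0 = 0) (h1 : 0 < w1 t0) : False := by
  have hom : 0 < 2 * π / T := by positivity
  have hpi : π / (2 * π / T) = T / 2 := by
    have := pi_pos.ne'
    field_simp
  have A := sturm_half_pos (2 * π / T) c hom (fun t => h (t0 + t)) (fun t => w (t0 + t))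
    (fun t => w1 (t0 + t)) (fun t => hhbd _) (fun t => (hw _).comp_const_add t0 t)
    (fun t => (hw1 _).comp_const_add t0 t) (by simpa using h0) (by simpa using h1)
  have B := sturm_half_pos (2 * π / T) (-c) hom (fun t => h (t0 + T - t)) (fun t => - w (t0 + T - t))
    (fun t => w1 (t0 + T - t)) (fun t => by simpa using hhbd _)
    (fun t => by simpa using ((hw _).comp_const_sub (t0 + T) t).fun_neg)
    (fun t => by
      refine HasDerivAt.congr_deriv ((hw1 _).comp_const_sub (t0 + T) t) ?_
      ring)
    (by simp [hper t0, h0]) (by simpa [hper1 t0] using h1)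
  simp only [hpi] at A B
  rw [show t0 + T - T / 2 = t0 + T / 2 by ring] at B
  linarith

lemma build (T c : ℝ) (hT : 0 < T) (h w w1 : ℝ → ℝ) (hh : Continuous h)
    (hw : ∀ t, HasDerivAt w (w1 t) t)
    (hw1 : ∀ t, HasDerivAt w1 (-c * w1 t - h t * w t) t)
    (hper : Function.Periodic w T) (hpos : ∀ t, 0 < w t) :
    ∃ v : ℝ → ℝ, ContDiff ℝ 2 v ∧ Function.Periodic v T ∧
      (∀ t, iteratedDeriv 2 v t - c * deriv v t + h t * v t = 0) ∧
      ∀ t, 0 < v t := by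
  have hwc : Continuous w := continuous_iff_continuousAt.2 fun t => (hw t).continuousAt
  let g : ℝ → ℝ := fun s => exp (-c * s) / w s ^ 2
  have hg : Continuous g := Continuous.div (by fun_prop) (by fun_prop)
    (fun s => (pow_pos (hpos s) 2).ne')
  have hgpos : ∀ s, 0 < g s := fun s => div_pos (exp_pos _) (pow_pos (hpos s) 2)
  have hgT : ∀ s, g (s + T) = exp (-c * T) * g s := by
    intro s
    simp only [g, hper s, mul_add, exp_add]
    ring
  have hgi : ∀ a b, IntervalIntegrable g volume a b := fun a b => hg.intervalIntegrable a b
  let P : ℝ → ℝ := fun t => ∫ s in t..(t + T), g s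
  have hPpos : ∀ t, 0 < P t := fun t =>
    intervalIntegral.intervalIntegral_pos_of_pos (hgi _ _) hgpos (by linarith)
  have hPT : ∀ t, P (t + T) = exp (-c * T) * P t := by
    intro t
    simp only [P]
    rw [← intervalIntegral.integral_comp_add_right g T, ← intervalIntegral.integral_const_mul]
    simp only [hgT]
  let k := exp (-c * T) - 1
  have hP : ∀ t, HasDerivAt P (k * g t) t := by
    intro t
    have e : P = fun t => (∫ s in (0:ℝ)..(t + T), g s) - ∫ s in (0:ℝ)..t, g s := by
      funext t
      exact (intervalIntegral.integral_interval_sub_left (hgi _ _) (hgi _ _)).symm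
    have d : ∀ x, HasDerivAt (fun x => ∫ s in (0:ℝ)..x, g s) (g x) x := fun x =>
      hg.integral_hasStrictDerivAt 0 x |>.hasDerivAt
    rw [e]
    refine HasDerivAt.congr_deriv (((d (t + T)).comp_add_const t T).fun_sub (d t)) ?_
    rw [hgT]
    simp only [k]
    ring
  let v : ℝ → ℝ := fun t => exp (c * t) * w t * P t
  let v1 : ℝ → ℝ := fun t => c * v t + (exp (c * t) * w1 t * P t + k * (w t)⁻¹)
  have e1 : ∀ t, HasDerivAt (fun t => exp (c * t)) (exp (c * t) * c) t := by
    intro t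
    simpa using ((hasDerivAt_id t).const_mul c).exp
  have hgv : ∀ t, exp (c * t) * g t = (w t ^ 2)⁻¹ := by
    intro t
    simp only [g]
    rw [← mul_div_assoc, ← exp_add]
    simp
  have hv : ∀ t, HasDerivAt v (v1 t) t := by
    intro t
    refine HasDerivAt.congr_deriv (((e1 t).fun_mul (hw t)).fun_mul (hP t)) ?_
    have : exp (c * t) * w t * (k * g t) = k * (w t)⁻¹ := by
      have h2 := (hpos t).ne'
      calc _ = k * w t * (exp (c * t) * g t) := by ring
        _ = _ := by rw [hgv]; field_simp
    rw [this]
    simp only [v1, v]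
    ring
  have hv1 : ∀ t, HasDerivAt v1 (c * v1 t - h t * v t) t := by
    intro t
    refine HasDerivAt.congr_deriv (((hv t).const_mul c).fun_add ((((e1 t).fun_mul (hw1 t)).fun_mul (hP t)).fun_add
      (((hw t).fun_inv (hpos t).ne').const_mul k))) ?_
    have : exp (c * t) * w1 t * (k * g t) = k * w1 t * (w t ^ 2)⁻¹ := by
      rw [← hgv]; ring
    rw [this]
    simp only [v]
    ring
  have hdv : deriv v = v1 := funext fun t => (hv t).deriv
  have hdv1 : deriv v1 = fun t => c * v1 t - h t * v t := funext fun t => (hv1 t).deriv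
  have hvc : Continuous v := continuous_iff_continuousAt.2 fun t => (hv t).continuousAt
  have hv1c : Continuous v1 := continuous_iff_continuousAt.2 fun t => (hv1 t).continuousAt
  refine ⟨v, ?_, ?_, ?_, ?_⟩
  · rw [show (2 : WithTop ℕ∞) = 1 + 1 by norm_num, contDiff_succ_iff_deriv]
    refine ⟨fun t => (hv t).differentiableAt, by simp, ?_⟩
    rw [hdv, contDiff_one_iff_deriv, hdv1]
    exact ⟨fun t => (hv1 t).differentiableAt, by fun_prop⟩
  · intro t
    simp only [v, hper t, hPT, mul_add, exp_add]
    have : exp (c * T) * exp (-c * T) = 1 := by rw [← exp_add]; simp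
    linear_combination (exp (c * t) * w t * P t) * this
  · intro t
    rw [iteratedDeriv_succ, iteratedDeriv_one, hdv, hdv1]
    ring
  · exact fun t => mul_pos (mul_pos (exp_pos _) (hpos t)) (hPpos t)

/-- If `h < c²/4 + ω²` and `w'' + c w' + h w = 0` has a nontrivial `T`-periodic
solution, then so does the adjoint problem `v'' − c v' + h v = 0`, with `v > 0`. -/
theorem adjoint_positive_solution (T c : ℝ) (hT : 0 < T) (h w : ℝ → ℝ)
    (hh : Continuous h) (hhper : Function.Periodic h T)
    (hhbd : ∀ t, h t < c ^ 2 / 4 + (2 * π / T) ^ 2)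
    (hw : ContDiff ℝ 2 w) (hwper : Function.Periodic w T)
    (hwne : ∃ t, w t ≠ 0)
    (heq : ∀ t, iteratedDeriv 2 w t + c * deriv w t + h t * w t = 0) :
    ∃ v : ℝ → ℝ, ContDiff ℝ 2 v ∧ Function.Periodic v T ∧
      (∀ t, iteratedDeriv 2 v t - c * deriv v t + h t * v t = 0) ∧
      ∀ t, 0 < v t := by
  have d0 : ∀ t, HasDerivAt w (deriv w t) t := fun t =>
    (hw.differentiable (by norm_num) t).hasDerivAt
  have d1 : ∀ t, HasDerivAt (deriv w) (-c * deriv w t - h t * w t) t := by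
    intro t
    have hd : ContDiff ℝ 1 (deriv w) := by
      rw [show (2 : WithTop ℕ∞) = 1 + 1 by norm_num, contDiff_succ_iff_deriv] at hw
      exact hw.2.2
    have := (hd.differentiable (by norm_num) t).hasDerivAt
    refine HasDerivAt.congr_deriv (this) ?_
    have h2 := heq t
    rw [iteratedDeriv_succ, iteratedDeriv_one] at h2
    linarith
  have hper1 : Function.Periodic (deriv w) T := by
    intro t
    rw [← deriv_comp_add_const]
    congr 1
    exact funext hwper
  have d0n : ∀ t, HasDerivAt (fun t => - w t) (- deriv w t) t := fun t => (d0 t).fun_neg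
  have d1n : ∀ t, HasDerivAt (fun t => - deriv w t) (-c * (-deriv w t) - h t * (- w t)) t := by
    intro t
    refine HasDerivAt.congr_deriv ((d1 t).fun_neg) ?_
    ring
  have hpern : Function.Periodic (fun t => - w t) T := fun t => by simp [hwper t]
  have hper1n : Function.Periodic (fun t => - deriv w t) T := fun t => by simp [hper1 t]
  have hne : ∀ t, w t ≠ 0 := by
    intro t0 h0
    rcases lt_trichotomy (deriv w t0) 0 with h1 | h1 | h1
    · exact no_zero T c hT h _ _ hhbd d0n d1n hpern hper1n t0 (by simp [h0]) (by simpa using h1)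
    · have hcomp := hhper.compact_of_continuous hT.ne' hh
      obtain ⟨M, hM⟩ := hcomp.isBounded.exists_norm_le
      obtain ⟨t, ht⟩ := hwne
      obtain ⟨n, hn⟩ := exists_nat_gt ((t0 - t) / T)
      rw [div_lt_iff₀ hT] at hn
      have := zero_of_cauchy c M h w (deriv w) (fun t => hM _ ⟨t, rfl⟩) d0 d1 t0 h0 h1
        (t + n * T) (by linarith)
      rw [hwper.nat_mul n t] at this
      exact ht this
    · exact no_zero T c hT h _ _ hhbd d0 d1 hwper hper1 t0 h0 h1
  by_cases hp : ∀ t, 0 < w t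
  · exact build T c hT h w _ hh d0 d1 hwper hp
  · refine build T c hT h _ _ hh d0n d1n hpern fun t => ?_
    push Not at hp
    obtain ⟨s, hs⟩ := hp
    rw [neg_pos]
    by_contra hc
    push Not at hc
    obtain ⟨x, hx⟩ := mem_range_of_exists_le_of_exists_ge hw.continuous ⟨s, hs⟩ ⟨t, hc⟩
    exact hne x hx
end
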